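/- Let (M,d) be a metric space, μ a Borel measure on M, f : M → ℝ μ-integrable with ∫_M f dμ = 0 and ∫_M |f(x)|·d(x₀,x) dμ(x) < ∞ for some x₀ ∈ M. Let u : M → ℝ be 1-Lipschitz with ∫_M u f dμ = sup{ ∫_M v f dμ : v 1-Lipschitz }. Define: a transport ray of u is a maximal subset I ⊆ M with |u(x)−u(y)| = d(x,y) for all x,y ∈ I; Inactive[u] is the set of x ∈ M such that {x} is a transport ray; Strain[u] is the set of strain points of u; Ends[u] = M \ (Inactive[u] ∪ Strain[u]); and a transport set is a Borel set A ⊆ M such that every transport ray meeting A \ Ends[u] is contained in A. Assume that Ends[u] is contained in a Borel set of μ-measure zero, and that the measure with density |f| with respect to μ is inner regular by compact sets on Borel sets. Then ∫_A f dμ = 0 for every transport set A. -/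

import Mathlib

open MeasureTheory

/-- A transport ray associated with a `1`-Lipschitz function `u` on a metric space: a maximal
set on which `u` changes exactly like the distance. -/
def IsTransportRay {X : Type*} [MetricSpace X] (u : X → ℝ) (I : Set X) : Prop :=
  (∀ x ∈ I, ∀ y ∈ I, |u x - u y| = dist x y) ∧
    ∀ J : Set X, I ⊆ J → (∀ x ∈ J, ∀ y ∈ J, |u x - u y| = dist x y) → J = I

/-- The set of strain points of `u`. -/
def strainSet {X : Type*} [MetricSpace X] (u : X → ℝ) : Set X :=
  {y | ∃ x z : X, u y - u x = dist x y ∧ 0 < dist x y ∧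
    u z - u y = dist y z ∧ 0 < dist y z ∧ dist x z = dist x y + dist y z}

/-- The union of all degenerate (singleton) transport rays. -/
def inactiveSet {X : Type*} [MetricSpace X] (u : X → ℝ) : Set X :=
  {x | IsTransportRay u {x}}

/-- `Ends[u] = M \ (Inactive[u] ∪ Strain[u])`. -/
def endsSet {X : Type*} [MetricSpace X] (u : X → ℝ) : Set X :=
  (inactiveSet u ∪ strainSet u)ᶜ

/-- A transport set: a Borel set containing every transport ray that meets `A \ Ends[u]`. -/
def IsTransportSet {X : Type*} [MetricSpace X] [MeasurableSpace X] (u : X → ℝ)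
    (A : Set X) : Prop :=
  MeasurableSet A ∧
    ∀ I : Set X, IsTransportRay u I → (I ∩ (A \ endsSet u)).Nonempty → I ⊆ A

theorem exists_ray_aux {X : Type*} [MetricSpace X] (u : X → ℝ) (S : Set X)
    (hS : ∀ x ∈ S, ∀ y ∈ S, |u x - u y| = dist x y) :
    ∃ I, S ⊆ I ∧ IsTransportRay u I := by
  obtain ⟨I, hSI, hI⟩ := zorn_subset_nonempty
    {I : Set X | ∀ x ∈ I, ∀ y ∈ I, |u x - u y| = dist x y} (by
      intro c hc hchain hne
      refine ⟨⋃₀ c, ?_, fun s hs => Set.subset_sUnion_of_mem hs⟩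
      rintro x ⟨s, hs, hxs⟩ y ⟨t, ht, hyt⟩
      rcases hchain.total hs ht with h | h
      · exact hc ht x (h hxs) y hyt
      · exact hc hs x hxs y (h hyt)) S hS
  refine ⟨I, hSI, hI.1, fun J hIJ hJ => ?_⟩
  exact Set.Subset.antisymm (hI.2 hJ hIJ) hIJ

open Classical in
noncomputable def uPert {X : Type*} [MetricSpace X] (u : X → ℝ) (K : Set X) (δ : ℝ) (x : X) : ℝ :=
  ⨅ y, (u y + dist x y - if y ∈ K then δ else 0)

section
variable {X : Type*} [MetricSpace X] {u : X → ℝ} (hu : LipschitzWith 1 u) (K : Set X) {δ : ℝ}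
  (hδ : 0 ≤ δ)
include hu hδ

theorem le_term (x y : X) : u x ≤ u y + dist x y := by
  have := hu.dist_le_mul x y
  rw [Real.dist_eq] at this
  have := (abs_le.1 this).2
  simp at this
  linarith

theorem uPert_bdd (x : X) :
    BddBelow (Set.range fun y => (u y + dist x y - (open Classical in if y ∈ K then δ else 0))) := by
  refine ⟨u x - δ, ?_⟩
  rintro _ ⟨y, rfl⟩
  have := le_term hu hδ x y
  dsimp only
  split_ifs <;> linarith

theorem uPert_ge (x : X) : u x - δ ≤ uPert u K δ x := by
  have : Nonempty X := ⟨x⟩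
  refine le_ciInf fun y => ?_
  have := le_term hu hδ x y
  split_ifs <;> linarith

theorem uPert_le (x : X) : uPert u K δ x ≤ u x := by
  refine (ciInf_le (uPert_bdd hu K hδ x) x).trans ?_
  simp
  split_ifs <;> linarith

theorem uPert_eq_mem (x : X) (hx : x ∈ K) : uPert u K δ x = u x - δ := by
  refine le_antisymm ?_ (uPert_ge hu K hδ x)
  refine (ciInf_le (uPert_bdd hu K hδ x) x).trans ?_
  simp [hx]

theorem uPert_eq_far (x : X) (hx : ∀ y ∈ K, u x + δ ≤ u y + dist x y) : uPert u K δ x = u x := by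
  refine le_antisymm (uPert_le hu K hδ x) ?_
  have : Nonempty X := ⟨x⟩
  refine le_ciInf fun y => ?_
  have := le_term hu hδ x y
  split_ifs with h
  · linarith [hx y h]
  · linarith

theorem uPert_lip : LipschitzWith 1 (uPert u K δ) := by
  refine LipschitzWith.of_le_add fun x y => ?_
  have : Nonempty X := ⟨x⟩
  rw [← sub_le_iff_le_add]
  refine le_ciInf fun z => ?_
  rw [sub_le_iff_le_add]
  refine (ciInf_le (uPert_bdd hu K hδ x) z).trans ?_
  have := dist_triangle x y z
  linarith
end

theorem far_aux {X : Type*} [MetricSpace X] {u : X → ℝ} (hu : LipschitzWith 1 u) {K : Set X}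
    (hK : IsCompact K) (x : X) (hx : ∀ y ∈ K, |u x - u y| ≠ dist x y) :
    ∃ c > 0, ∀ y ∈ K, u x + c ≤ u y + dist x y := by
  rcases K.eq_empty_or_nonempty with rfl | hne
  · exact ⟨1, one_pos, by simp⟩
  obtain ⟨y, hy, hmin⟩ := hK.exists_isMinOn hne (f := fun y => u y + dist x y)
    (hu.continuous.add (continuous_const.dist continuous_id)).continuousOn
  refine ⟨u y + dist x y - u x, ?_, fun z hz => ?_⟩
  · have h1 := le_term hu le_rfl x y
    have h2 : u x ≠ u y + dist x y := by
      intro h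
      apply hx y hy
      rw [h, add_sub_cancel_left, abs_of_nonneg dist_nonneg]
    have := lt_of_le_of_ne h1 h2
    linarith
  · have := hmin hz
    simp at this
    linarith

theorem lip_mul_integrable {X : Type*} [MetricSpace X]
    [MeasurableSpace X] [BorelSpace X]
    {μ : Measure X} {f : X → ℝ} (hf : Integrable f μ)
    {x₀ : X} (hfd : Integrable (fun x => |f x| * dist x₀ x) μ)
    {u : X → ℝ} (hu : LipschitzWith 1 u) : Integrable (fun x => u x * f x) μ := by
  refine Integrable.mono' ((hf.abs.const_mul |u x₀|).add hfd)
    (hu.continuous.aestronglyMeasurable.mul hf.aestronglyMeasurable) (Filter.Eventually.of_forall ?_)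
  intro x
  have h := hu.dist_le_mul x x₀
  rw [Real.dist_eq] at h
  have h2 : |u x| ≤ |u x₀| + dist x₀ x := by
    have := abs_sub_abs_le_abs_sub (u x) (u x₀)
    simp at h
    rw [dist_comm x₀ x]
    linarith
  simp only [Real.norm_eq_abs, abs_mul, Pi.add_apply]
  nlinarith [abs_nonneg (f x)]

theorem main_ineq {X : Type*} [MetricSpace X]
    [MeasurableSpace X] [BorelSpace X]
    (μ : Measure X) (f : X → ℝ) (hf : Integrable f μ)
    (x₀ : X) (hfd : Integrable (fun x => |f x| * dist x₀ x) μ)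
    (u : X → ℝ) (hu : LipschitzWith 1 u)
    (hmax : ∀ v : X → ℝ, LipschitzWith 1 v → ∫ x, v x * f x ∂μ ≤ ∫ x, u x * f x ∂μ)
    (A K : Set X) (hA : MeasurableSet A) (hK : IsCompact K)
    (hsep : ∀ x ∉ A, ∀ y ∈ K, |u x - u y| ≠ dist x y) :
    0 ≤ ∫ x in A, f x ∂μ + ∫ x in A \ K, 2 * |f x| ∂μ := by
  have hKm := hK.measurableSet
  set δ : ℕ → ℝ := fun n => 1 / ((n : ℝ) + 1) with hδd
  have hδ : ∀ n, 0 < δ n := fun n => by positivity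
  set g : ℕ → X → ℝ := fun n x => (u x - uPert u K (δ n) x) / δ n with hg
  have g0 : ∀ n x, 0 ≤ g n x := fun n x =>
    div_nonneg (sub_nonneg.2 (uPert_le hu K (hδ n).le x)) (hδ n).le
  have g1 : ∀ n x, g n x ≤ 1 := fun n x => by
    rw [hg]; dsimp only
    rw [div_le_one (hδ n)]
    linarith [uPert_ge hu K (hδ n).le x]
  have gK : ∀ n, ∀ x ∈ K, g n x = 1 := fun n x hx => by
    rw [hg]; dsimp only
    rw [uPert_eq_mem hu K (hδ n).le x hx, sub_sub_cancel, div_self (hδ n).ne']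
  have gc : ∀ n, Continuous (g n) := fun n =>
    (hu.continuous.sub (uPert_lip hu K (hδ n).le).continuous).div_const _
  have gf_meas : ∀ n, AEStronglyMeasurable (fun x => g n x * f x) μ := fun n =>
    (gc n).aestronglyMeasurable.mul hf.aestronglyMeasurable
  have gf_bd : ∀ n x, ‖g n x * f x‖ ≤ |f x| := fun n x => by
    rw [Real.norm_eq_abs, abs_mul, abs_of_nonneg (g0 n x)]
    exact mul_le_of_le_one_left (abs_nonneg _) (g1 n x)
  have gf_int : ∀ n, Integrable (fun x => g n x * f x) μ := fun n =>
    hf.abs.mono' (gf_meas n) (Filter.Eventually.of_forall (gf_bd n))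
  have gpos : ∀ n, 0 ≤ ∫ x, g n x * f x ∂μ := fun n => by
    have h := hmax _ (uPert_lip hu K (hδ n).le)
    have e : ∫ x, g n x * f x ∂μ
        = (∫ x, u x * f x ∂μ - ∫ x, uPert u K (δ n) x * f x ∂μ) / δ n := by
      rw [← integral_sub (lip_mul_integrable hf hfd hu)
        (lip_mul_integrable hf hfd (uPert_lip hu K (hδ n).le)), ← integral_div]
      congr 1; ext x; simp only [hg]; ring
    rw [e]
    exact div_nonneg (sub_nonneg.2 h) (hδ n).le
  have lim : Filter.Tendsto (fun n => ∫ x in Aᶜ, g n x * f x ∂μ) Filter.atTop (nhds 0) := by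
    have : Filter.Tendsto (fun n => ∫ x in Aᶜ, g n x * f x ∂μ) Filter.atTop
        (nhds (∫ x in Aᶜ, (0:ℝ) ∂μ)) := by
      refine tendsto_integral_of_dominated_convergence (fun x => |f x|)
        (fun n => (gf_meas n).restrict) hf.abs.integrableOn
        (fun n => Filter.Eventually.of_forall (gf_bd n)) ?_
      filter_upwards [ae_restrict_mem hA.compl] with x hx
      obtain ⟨c, hc, hfar⟩ := far_aux hu hK x (hsep x hx)
      refine tendsto_const_nhds.congr' ?_
      have hev : ∀ᶠ n in Filter.atTop, δ n < c :=
        (tendsto_one_div_add_atTop_nhds_zero_nat (𝕜 := ℝ)).eventually_lt_const hc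
      filter_upwards [hev] with n hn
      have : g n x = 0 := by
        rw [hg]; dsimp only
        rw [uPert_eq_far hu K (hδ n).le x (fun y hy => by linarith [hfar y hy])]
        simp
      simp [this]
    simpa using this
  have key : ∀ n, 0 ≤ (∫ x in A, f x ∂μ + ∫ x in A \ K, 2 * |f x| ∂μ)
      + ∫ x in Aᶜ, g n x * f x ∂μ := fun n => by
    have h1 := gpos n
    rw [← integral_add_compl hA (gf_int n)] at h1
    have h2 : ∫ x in A, g n x * f x ∂μ ≤ ∫ x in A, f x ∂μ + ∫ x in A \ K, 2 * |f x| ∂μ := by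
      have e : ∫ x in A \ K, 2 * |f x| ∂μ
          = ∫ x in A, Set.indicator Kᶜ (fun x => 2 * |f x|) x ∂μ := by
        rw [setIntegral_indicator hKm.compl, Set.sdiff_eq]
      have hi : Integrable (Set.indicator Kᶜ (fun x => 2 * |f x|)) μ :=
        (hf.abs.const_mul 2).indicator hKm.compl
      rw [e, ← integral_add hf.integrableOn hi.integrableOn]
      refine integral_mono (gf_int n).integrableOn (hf.integrableOn.add hi.integrableOn) ?_
      intro x
      by_cases hx : x ∈ K
      · simp [hx, gK n x hx]
      · simp only [Set.indicator_of_mem (show x ∈ Kᶜ from hx)]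
        have := (le_abs_self _).trans (gf_bd n x)
        have := neg_abs_le (f x)
        linarith
    linarith
  have := ge_of_tendsto' (lim.const_add _) key
  simpa using this

theorem one_side {X : Type*} [MetricSpace X]
    [MeasurableSpace X] [BorelSpace X]
    (μ : Measure X) (f : X → ℝ) (hf : Integrable f μ)
    (x₀ : X) (hfd : Integrable (fun x => |f x| * dist x₀ x) μ)
    (u : X → ℝ) (hu : LipschitzWith 1 u)
    (hmax : ∀ v : X → ℝ, LipschitzWith 1 v → ∫ x, v x * f x ∂μ ≤ ∫ x, u x * f x ∂μ)
    (hreg : (μ.withDensity fun x => ENNReal.ofReal |f x|).InnerRegular)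
    (A B : Set X) (hA : MeasurableSet A) (hB : MeasurableSet B) (hB0 : μ B = 0)
    (hsep : ∀ x ∉ A, ∀ y ∈ A \ B, |u x - u y| ≠ dist x y) :
    0 ≤ ∫ x in A, f x ∂μ := by
  set ν := μ.withDensity fun x => ENNReal.ofReal |f x| with hν
  have : IsFiniteMeasure ν := isFiniteMeasure_withDensity_ofReal hf.abs.2
  refine le_of_forall_pos_le_add fun ε hε => ?_
  obtain ⟨K, hKs, hK, hKlt⟩ := (hA.diff hB).exists_isCompact_sdiff_lt (μ := ν)
    (measure_ne_top _ _) (ε := ENNReal.ofReal (ε / 2)) (by simpa using hε)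
  have h := main_ineq μ f hf x₀ hfd u hu hmax A K hA hK (fun x hx y hy => hsep x hx y (hKs hy))
  have hνB : ν B = 0 := withDensity_absolutelyContinuous _ _ hB0
  have h3 : ν (A \ K) < ENNReal.ofReal (ε / 2) := by
    refine lt_of_le_of_lt ?_ hKlt
    calc ν (A \ K) ≤ ν (((A \ B) \ K) ∪ B) := measure_mono (by
            intro x hx
            by_cases hxB : x ∈ B
            · exact Or.inr hxB
            · exact Or.inl ⟨⟨hx.1, hxB⟩, hx.2⟩)
      _ ≤ ν ((A \ B) \ K) + ν B := measure_union_le _ _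
      _ = _ := by rw [hνB, add_zero]
  rw [hν, withDensity_apply _ (hA.diff hK.measurableSet),
    ← ofReal_integral_eq_lintegral_ofReal hf.abs.integrableOn
      (Filter.Eventually.of_forall fun x => abs_nonneg _),
    ENNReal.ofReal_lt_ofReal_iff (by linarith)] at h3
  rw [integral_const_mul] at h
  linarith

/-- If `u` is a Kantorovich maximizer for `f`, `Ends[u]` is contained in a Borel null set and
the measure `|f| dμ` is inner regular by compact sets, then `∫_A f dμ = 0` for every
transport set `A`. -/
theorem integral_transportSet_eq_zero {X : Type*} [MetricSpace X]
    [MeasurableSpace X] [BorelSpace X]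
    (μ : Measure X) (f : X → ℝ) (hf : Integrable f μ) (hf0 : ∫ x, f x ∂μ = 0)
    (x₀ : X) (hfd : Integrable (fun x => |f x| * dist x₀ x) μ)
    (u : X → ℝ) (hu : LipschitzWith 1 u)
    (hmax : ∀ v : X → ℝ, LipschitzWith 1 v → ∫ x, v x * f x ∂μ ≤ ∫ x, u x * f x ∂μ)
    (hends : ∃ B : Set X, MeasurableSet B ∧ μ B = 0 ∧ endsSet u ⊆ B)
    (hreg : (μ.withDensity fun x => ENNReal.ofReal |f x|).InnerRegular) :
    ∀ A : Set X, IsTransportSet u A → ∫ x in A, f x ∂μ = 0 := by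
  intro A hAt
  obtain ⟨B, hB, hB0, hEB⟩ := hends
  have hsep : ∀ x ∉ A, ∀ y ∈ A \ B, |u x - u y| ≠ dist x y := by
    intro x hx y hy h
    obtain ⟨I, hSI, hI⟩ := exists_ray_aux u {x, y} (by
      have h' : |u y - u x| = dist y x := by rw [abs_sub_comm, dist_comm, h]
      rintro a (rfl | rfl) b (rfl | rfl) <;> simp [h, h'])
    exact hx (hAt.2 I hI ⟨y, hSI (by simp), hy.1, fun hE => hy.2 (hEB hE)⟩ (hSI (by simp)))
  refine le_antisymm ?_ (one_side μ f hf x₀ hfd u hu hmax hreg A B hAt.1 hB hB0 hsep)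
  have h := one_side μ (fun x => - f x) hf.neg x₀ (by simpa using hfd) (fun x => - u x)
    hu.neg (fun v hv => by
      have := hmax (fun x => - v x) hv.neg
      simpa [integral_neg] using this) (by simpa using hreg) A B hAt.1 hB hB0 (by
      intro x hx y hy h
      apply hsep x hx y hy
      rw [← h, abs_sub_comm]
      congr 1; ring)
  rw [integral_neg] at h
  linarith
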